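/- Let A be a noetherian local ring and M a finitely generated A-module of finite projective dimension, and let i ≥ 0. Then M is an i-th syzygy (of some finitely generated module, in a resolution by finitely generated free modules) if and only if for every prime ideal p of A, either depth M_p ≥ i or M_p is a free A_p-module. -/

import Mathlib

open CategoryTheory

noncomputable section

/-- We equip module categories with their standard derived category structure,
so that small `Ext`-groups are available. -/
instance extHDC (R : Type) [CommRing R] : HasDerivedCategory (ModuleCat.{0} R) :=
  HasDerivedCategory.standard _

instance extHasExt (R : Type) [CommRing R] : HasExt.{1} (ModuleCat.{0} R) :=
  hasExt_of_hasDerivedCategory _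

/-- The `Ext`-group `Ext^n_R(M, N)` of two `R`-modules. -/
abbrev extGrp (R : Type) [CommRing R] (M N : Type) [AddCommGroup M] [Module R M]
    [AddCommGroup N] [Module R N] (n : ℕ) : Type 1 :=
  Abelian.Ext (ModuleCat.of R M) (ModuleCat.of R N) n

/-- The Ext-depth of a module `M` over a local ring `R`:
`E-dp M = inf {n | Ext^n_R(k, M) ≠ 0}` where `k` is the residue field (`⊤` if no such `n`). -/
def extDepth (R : Type) [CommRing R] [IsLocalRing R] (M : Type) [AddCommGroup M]
    [Module R M] : ℕ∞ :=
  sInf {n : ℕ∞ | ∃ i : ℕ, n = i ∧ Nontrivial (extGrp R (IsLocalRing.ResidueField R) M i)}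

/-- `IsSyzygy A i M` : `M` is an `i`-th syzygy, i.e. there is an exact sequence
`0 → M → F_{i-1} → ⋯ → F_0` with the `F_j` finitely generated free. -/
def IsSyzygy (A : Type) [CommRing A] : ℕ → (M : Type) → [AddCommGroup M] → [Module A M] → Prop
  | 0, _M, _, _ => True
  | (i+1), M, _, _ => ∃ (n : ℕ) (f : M →ₗ[A] (Fin n → A)), Function.Injective f ∧
      IsSyzygy A i ((Fin n → A) ⧸ LinearMap.range f)

/-- `M` has finite projective dimension: `Ext^i(M, -)` vanishes for all large `i`. -/
def HasFinitePD (R : Type) [CommRing R] (M : Type) [AddCommGroup M] [Module R M] : Prop :=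
  ∃ n : ℕ, ∀ i : ℕ, n < i → ∀ N : ModuleCat.{0} R,
    Subsingleton (Abelian.Ext (ModuleCat.of R M) N i)

/-- `M` has finite injective dimension: `Ext^i(-, M)` vanishes for all large `i`. -/
def HasFiniteInjDim (R : Type) [CommRing R] (M : Type) [AddCommGroup M] [Module R M] : Prop :=
  ∃ n : ℕ, ∀ i : ℕ, n < i → ∀ N : ModuleCat.{0} R,
    Subsingleton (Abelian.Ext N (ModuleCat.of R M) i)

open Abelian

/-- vanishing of Ext -/
abbrev ExtZ (R : Type) [CommRing R] (k M : Type) [AddCommGroup k] [Module R k]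
    [AddCommGroup M] [Module R M] (j : ℕ) : Prop := Subsingleton (extGrp R k M j)

lemma le_extDepth_iff (R : Type) [CommRing R] [IsLocalRing R] (M : Type) [AddCommGroup M]
    [Module R M] (i : ℕ) : (i : ℕ∞) ≤ extDepth R M ↔
      ∀ j < i, ExtZ R (IsLocalRing.ResidueField R) M j := by
  unfold extDepth
  rw [le_sInf_iff]
  constructor
  · intro h j hj
    by_contra hc
    rw [not_subsingleton_iff_nontrivial] at hc
    have := h (j : ℕ∞) ⟨j, rfl, hc⟩
    have := Nat.cast_le.mp this
    omega
  · rintro h _ ⟨j, rfl, hj⟩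
    by_contra hc
    have hc' : j < i := by simpa using hc
    have := h j hc'
    exact not_subsingleton _ this

section

variable {R : Type} [CommRing R] {k X Y Z : Type} [AddCommGroup k] [Module R k]
  [AddCommGroup X] [Module R X] [AddCommGroup Y] [Module R Y] [AddCommGroup Z] [Module R Z]

lemma mkShortExact (f : X →ₗ[R] Y) (g : Y →ₗ[R] Z) (hf : Function.Injective f)
    (hfg : Function.Exact f g) (hg : Function.Surjective g) :
    (ShortComplex.mk (ModuleCat.ofHom f) (ModuleCat.ofHom g)
      (by rw [← ModuleCat.ofHom_comp, hfg.linearMap_comp_eq_zero]; rfl)).ShortExact :=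
  ModuleCat.shortComplex_shortExact _ hfg hf hg

/-- the map induced on Ext -/
def extMap (k : Type) [AddCommGroup k] [Module R k] (f : X →ₗ[R] Y) (j : ℕ) :
    extGrp R k X j →+ extGrp R k Y j :=
  (Ext.mk₀ (ModuleCat.ofHom f)).postcomp (ModuleCat.of R k) (add_zero j)

lemma extMap_id (j : ℕ) (x : extGrp R k X j) : extMap k (LinearMap.id : X →ₗ[R] X) j x = x := by
  simp [extMap]

lemma extMap_comp (f : X →ₗ[R] Y) (g : Y →ₗ[R] Z) (j : ℕ) (x : extGrp R k X j) :
    extMap k (g ∘ₗ f) j x = extMap k g j (extMap k f j x) := by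
  simp [extMap]

lemma extMap_add (f g : X →ₗ[R] Y) (j : ℕ) (x : extGrp R k X j) :
    extMap k (f + g) j x = extMap k f j x + extMap k g j x := by
  simp [extMap, ModuleCat.ofHom_add, Ext.mk₀_add]

lemma extMap_zero (j : ℕ) (x : extGrp R k X j) :
    extMap k (0 : X →ₗ[R] Y) j x = 0 := by
  have := extMap_add (0 : X →ₗ[R] Y) 0 j x
  simpa using this

lemma extMap_sum {ι : Type} (s : Finset ι) (f : ι → X →ₗ[R] Y) (j : ℕ) (x : extGrp R k X j) :
    extMap k (∑ i ∈ s, f i) j x = ∑ i ∈ s, extMap k (f i) j x := by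
  classical
  induction s using Finset.induction_on with
  | empty => simp [extMap_zero]
  | insert a s ha ih => rw [Finset.sum_insert ha, Finset.sum_insert ha, extMap_add, ih]

lemma extMap_smul_id (r : R) (hr : r ∈ Module.annihilator R k) (j : ℕ) (x : extGrp R k X j) :
    extMap k (r • LinearMap.id : X →ₗ[R] X) j x = 0 := by
  have h0 : r • 𝟙 (ModuleCat.of R k) = 0 := by
    ext y
    exact Module.mem_annihilator.mp hr y
  have smul_eq : r • x = (Ext.mk₀ (r • 𝟙 (ModuleCat.of R k))).comp x (zero_add j) := by
    simp [Ext.mk₀_smul]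
  have h1 : extMap k (r • LinearMap.id : X →ₗ[R] X) j x = r • x := by
    rw [Ext.smul_eq_comp_mk₀]
    rfl
  rw [h1, smul_eq, h0, Ext.mk₀_zero, Ext.zero_comp]

lemma extMap_injective (f : X →ₗ[R] Y) (g : Y →ₗ[R] Z) (hf : Function.Injective f)
    (hfg : Function.Exact f g) (hg : Function.Surjective g) (j : ℕ)
    (h : ∀ j', j' + 1 = j → ExtZ R k Z j') (x : extGrp R k X j)
    (hx : extMap k f j x = 0) : x = 0 := by
  cases j with
  | zero =>
    obtain ⟨φ, rfl⟩ := (Ext.mk₀_bijective _ _).2 x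
    have : φ ≫ ModuleCat.ofHom f = 0 := by simpa [extMap] using hx
    have hm : Mono (ModuleCat.ofHom f) := (ModuleCat.mono_iff_injective _).2 hf
    rw [Limits.zero_of_comp_mono _ this, Ext.mk₀_zero]
  | succ j =>
    obtain ⟨y, rfl⟩ := Ext.covariant_sequence_exact₁ _ (mkShortExact f g hf hfg hg) x hx rfl
    have := h j rfl
    have hy : y = 0 := Subsingleton.elim _ _
    rw [hy, Ext.zero_comp]

lemma extZ_left (f : X →ₗ[R] Y) (g : Y →ₗ[R] Z) (hf : Function.Injective f)
    (hfg : Function.Exact f g) (hg : Function.Surjective g) (j : ℕ)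
    (h : ∀ j', j' + 1 = j → ExtZ R k Z j') (hY : ExtZ R k Y j) : ExtZ R k X j :=
  subsingleton_of_forall_eq 0 fun x ↦
    extMap_injective f g hf hfg hg j h x (Subsingleton.elim _ _)

lemma extZ_right (f : X →ₗ[R] Y) (g : Y →ₗ[R] Z) (hf : Function.Injective f)
    (hfg : Function.Exact f g) (hg : Function.Surjective g) (j : ℕ)
    (hX : ExtZ R k X (j + 1)) (hY : ExtZ R k Y j) : ExtZ R k Z j :=
  subsingleton_of_forall_eq 0 fun x ↦ by
    obtain ⟨y, rfl⟩ := Ext.covariant_sequence_exact₃ _ (mkShortExact f g hf hfg hg) x rfl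
      (Subsingleton.elim (α := extGrp R k X (j + 1)) _ _)
    have hy : y = 0 := Subsingleton.elim (α := extGrp R k Y j) _ _
    rw [hy, Ext.zero_comp]

lemma extZ_retract (f : X →ₗ[R] Y) (g : Y →ₗ[R] X) (h : g ∘ₗ f = LinearMap.id) (j : ℕ)
    (hY : ExtZ R k Y j) : ExtZ R k X j :=
  subsingleton_of_forall_eq 0 fun x ↦ by
    rw [← extMap_id j x, ← h, extMap_comp, Subsingleton.elim (extMap k f j x) 0, map_zero]

lemma extZ_free [Module.Free R X] [Module.Finite R X] (j : ℕ) (h : ExtZ R k R j) :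
    ExtZ R k X j :=
  subsingleton_of_forall_eq 0 fun x ↦ by
    let b := Module.Free.chooseBasis R X
    have hid : (LinearMap.id : X →ₗ[R] X) =
        ∑ i, (LinearMap.toSpanSingleton R X (b i)) ∘ₗ b.coord i := by
      ext y
      simp [b.sum_repr y]
    rw [← extMap_id j x, hid, extMap_sum]
    refine Finset.sum_eq_zero fun i _ ↦ ?_
    rw [extMap_comp, Subsingleton.elim (extMap k (b.coord i) j x) 0, map_zero]

lemma extZ_of_free [Module.Free R X] [Nontrivial X] (j : ℕ) (h : ExtZ R k X j) :
    ExtZ R k R j := by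
  let b := Module.Free.chooseBasis R X
  have : Nonempty (Module.Free.ChooseBasisIndex R X) := b.index_nonempty
  obtain ⟨i⟩ := this
  refine extZ_retract (LinearMap.toSpanSingleton R X (b i)) (b.coord i) ?_ j h
  ext
  simp

lemma extMap_zero_of_range [Module.Free R X] [Module.Finite R X] (f : X →ₗ[R] Y)
    (I : Ideal R) (hI : I ≤ Module.annihilator R k) (hf : LinearMap.range f ≤ I • ⊤)
    (j : ℕ) (x : extGrp R k X j) : extMap k f j x = 0 := by
  let b := Module.Free.chooseBasis R X
  have hid : f = ∑ i, (LinearMap.toSpanSingleton R Y (f (b i))) ∘ₗ b.coord i := by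
    ext y
    conv_lhs => rw [← b.sum_repr y, map_sum]
    simp only [map_smul]
    simp
  rw [hid, extMap_sum]
  refine Finset.sum_eq_zero fun i _ ↦ ?_
  have hi : f (b i) ∈ I • (⊤ : Submodule R Y) := hf ⟨_, rfl⟩
  rw [extMap_comp]
  refine Submodule.smul_induction_on hi (fun r hr y _ ↦ ?_) (fun y z hy hz ↦ ?_)
  · have : LinearMap.toSpanSingleton R Y (r • y) =
      (r • LinearMap.id) ∘ₗ LinearMap.toSpanSingleton R Y y := by ext; simp
    rw [this, extMap_comp, extMap_smul_id r (hI hr)]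
  · have : LinearMap.toSpanSingleton R Y (y + z) =
      LinearMap.toSpanSingleton R Y y + LinearMap.toSpanSingleton R Y z := by ext; simp
    rw [this, extMap_add, hy, hz, add_zero]

end

lemma exists_minimal_cover (R : Type) [CommRing R] [IsLocalRing R] (N : Type) [AddCommGroup N]
    [Module R N] [Module.Finite R N] : ∃ (n : ℕ) (π : (Fin n → R) →ₗ[R] N),
      Function.Surjective π ∧ LinearMap.ker π ≤ IsLocalRing.maximalIdeal R • ⊤ := by
  classical
  let k := IsLocalRing.ResidueField R
  let b := Module.finBasis k (TensorProduct R k N)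
  have hs : Function.Surjective (TensorProduct.mk R k N 1) :=
    TensorProduct.mk_surjective R N k Ideal.Quotient.mk_surjective
  choose v hv using fun i ↦ hs (b i)
  refine ⟨_, Fintype.linearCombination R v, ?_, ?_⟩
  · rw [← LinearMap.range_eq_top, Fintype.range_linearCombination]
    exact IsLocalRing.span_eq_top_of_tmul_eq_basis v b hv
  · intro a ha
    have h1 : ∑ i, a i • v i = 0 := by simpa [Fintype.linearCombination_apply] using ha
    have h2 : ∑ i, (IsLocalRing.residue R (a i)) • b i = 0 := by
      have := congrArg (TensorProduct.mk R k N 1) h1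
      rw [map_sum, map_zero] at this
      rw [← this]
      refine Finset.sum_congr rfl fun i _ ↦ ?_
      rw [map_smul, hv i]
      rfl
    have h3 := Fintype.linearIndependent_iff.mp b.linearIndependent _ h2
    rw [← Finset.univ_sum_single a]
    refine Submodule.sum_mem _ fun i _ ↦ ?_
    have : (Pi.single i (a i) : Fin _ → R) = a i • Pi.single i 1 := by
      rw [← Pi.single_smul]; simp
    rw [this]
    exact Submodule.smul_mem_smul ((IsLocalRing.residue_eq_zero_iff _).mp (h3 i)) trivial

lemma projDim_left {R : Type} [CommRing R] {X Y Z : Type} 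
    [AddCommGroup X] [Module R X] [AddCommGroup Y] [Module R Y] [AddCommGroup Z] [Module R Z]
    (f : X →ₗ[R] Y) (g : Y →ₗ[R] Z) (hf : Function.Injective f)
    (hfg : Function.Exact f g) (hg : Function.Surjective g) [Module.Projective R Y] (n : ℕ) :
    HasProjectiveDimensionLT (ModuleCat.of R Z) (n + 2) ↔
      HasProjectiveDimensionLT (ModuleCat.of R X) (n + 1) :=
  (mkShortExact f g hf hfg hg).hasProjectiveDimensionLT_X₃_iff n
    ((IsProjective.iff_projective Y).mp inferInstance)

/-- Key part of the Auslander–Buchsbaum formula. -/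
lemma auslander_buchsbaum (R : Type) [CommRing R] [IsNoetherianRing R] [IsLocalRing R]
    (m : ℕ) : ∀ (N : Type) [AddCommGroup N] [Module R N] [Module.Finite R N],
    HasProjectiveDimensionLT (ModuleCat.of R N) (m + 1) → ¬ Module.Free R N →
    ∀ n : ℕ, (∀ j < n, ExtZ R (IsLocalRing.ResidueField R) N j) →
    ∀ j ≤ n, ExtZ R (IsLocalRing.ResidueField R) R j := by
  induction m with
  | zero =>
    intro N _ _ _ hpd hfree
    exfalso
    have := (IsProjective.iff_projective N).mpr
      (projective_iff_hasProjectiveDimensionLT_one.mpr hpd)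
    exact hfree (Module.free_of_flat_of_isLocalRing)
  | succ m ih =>
    intro N _ _ _ hpd hfree n
    obtain ⟨r, π, hπ, hker⟩ := exists_minimal_cover R N
    have hex : Function.Exact (LinearMap.ker π).subtype π :=
      LinearMap.exact_subtype_ker_map π
    have hinj := (LinearMap.ker π).injective_subtype
    have hpdK := (projDim_left _ π hinj hex hπ m).mp hpd
    have step : ∀ n : ℕ, (∀ j < n, ExtZ R (IsLocalRing.ResidueField R) N j) →
        (∀ j < n, ExtZ R (IsLocalRing.ResidueField R) R j) →
        ExtZ R (IsLocalRing.ResidueField R) R n := by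
      intro n hN hR
      by_cases hK : Module.Free R (LinearMap.ker π)
      · have hnt : Nontrivial (LinearMap.ker π) := by
          by_contra hc
          rw [not_nontrivial_iff_subsingleton, Submodule.subsingleton_iff_eq_bot] at hc
          exact hfree (Module.Free.of_equiv (LinearEquiv.ofBijective π
            ⟨LinearMap.ker_eq_bot.mp hc, hπ⟩))
        refine extZ_of_free (X := LinearMap.ker π) n (subsingleton_of_forall_eq 0 fun x ↦ ?_)
        refine extMap_injective _ π hinj hex hπ n (fun j' hj' ↦ hN j' (by omega)) x ?_
        refine extMap_zero_of_range _ (IsLocalRing.maximalIdeal R) ?_ ?_ n x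
        · exact (Ideal.annihilator_quotient (I := IsLocalRing.maximalIdeal R)).ge
        · rwa [Submodule.range_subtype]
      · refine ih (LinearMap.ker π) hpdK hK n (fun j hj ↦ ?_) n le_rfl
        exact extZ_left _ π hinj hex hπ j (fun j' hj' ↦ hN j' (by omega)) (extZ_free j (hR j hj))
    induction n with
    | zero =>
      intro hN j hj
      obtain rfl : j = 0 := by omega
      exact step 0 hN (by simp)
    | succ n ihn =>
      intro hN j hj
      have h := ihn (fun j hj ↦ hN j (by omega))
      rcases Nat.lt_or_ge n j with h' | h'
      · obtain rfl : j = n + 1 := by omega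
        exact step _ hN (fun j hj ↦ h j (by omega))
      · exact h j h'

section

variable {A : Type} [CommRing A] {M : Type} [AddCommGroup M] [Module A M]

lemma HasFinitePD.exists_lt (h : HasFinitePD A M) :
    ∃ m, HasProjectiveDimensionLT (ModuleCat.of A M) (m + 1) := by
  obtain ⟨n, hn⟩ := h
  refine ⟨n, (hasProjectiveDimensionLT_iff.{1} _ _).mpr fun i hi Y e ↦ ?_⟩
  have := hn i (by omega) Y
  exact Subsingleton.elim _ _

lemma localized_pd (S : Submonoid A) (m : ℕ)
    (h : HasProjectiveDimensionLT (ModuleCat.of A M) (m + 1)) :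
    HasProjectiveDimensionLT (ModuleCat.of (Localization S) (LocalizedModule S M)) (m + 1) := by
  have h1 : HasProjectiveDimensionLE (ModuleCat.of A M) m := h
  have := ModuleCat.localizedModule_hasProjectiveDimensionLE m S (ModuleCat.of A M)
  let e : (ModuleCat.of A M).localizedModule S ≃ₗ[Localization S]
    (ModuleCat.of (Localization S) (LocalizedModule S M)) :=
      Shrink.linearEquiv (Localization S) (LocalizedModule S M)
  exact ModuleCat.hasProjectiveDimensionLE_of_linearEquiv e m

/-- Localizing a syzygy: vanishing of Ext. -/
lemma syzygy_extZ (p : Ideal A) [p.IsPrime] (k : Type) [AddCommGroup k]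
    [Module (Localization.AtPrime p) k] (n : ℕ)
    (hR : ∀ j < n, ExtZ (Localization.AtPrime p) k (Localization.AtPrime p) j) :
    ∀ (i : ℕ) (M : Type) [AddCommGroup M] [Module A M], IsSyzygy A i M → ∀ j < n, j < i →
      ExtZ (Localization.AtPrime p) k (LocalizedModule p.primeCompl M) j := by
  intro i
  induction i with
  | zero => intro M _ _ _ j _ h; omega
  | succ i ih =>
    intro M _ _ hM j hj hji
    obtain ⟨r, f, hf, hC⟩ := hM
    have hex : Function.Exact f (LinearMap.range f).mkQ :=
      LinearMap.exact_map_mkQ_range f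
    refine extZ_left (LocalizedModule.map p.primeCompl f)
      (LocalizedModule.map p.primeCompl (LinearMap.range f).mkQ)
      (LocalizedModule.map_injective _ _ hf) (LocalizedModule.map_exact _ _ _ hex)
      (LocalizedModule.map_surjective _ _ (Submodule.mkQ_surjective _)) j
      (fun j' hj' ↦ ih _ hC j' (by omega) (by omega)) ?_
    have : Module.Free (Localization.AtPrime p) (LocalizedModule p.primeCompl (Fin r → A)) :=
      Module.free_of_isLocalizedModule p.primeCompl (LocalizedModule.mkLinearMap p.primeCompl _)
    exact extZ_free j (hR j hj)

variable [IsNoetherianRing A] [Module.Finite A M]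

lemma exists_dual_gen (A : Type) [CommRing A] [IsNoetherianRing A] (M : Type) [AddCommGroup M]
    [Module A M] [Module.Finite A M] : ∃ (n : ℕ) (f : M →ₗ[A] (Fin n → A)),
      ∀ φ : M →ₗ[A] A, ∃ ψ : (Fin n → A) →ₗ[A] A, ψ ∘ₗ f = φ := by
  have : Module.Finite A (M →ₗ[A] A) := by
    obtain ⟨r, π, hπ⟩ := Module.Finite.exists_fin' A M
    exact Module.Finite.of_injective (LinearMap.lcomp A A π)
      (fun a b h ↦ LinearMap.ext fun x ↦ by
        obtain ⟨y, rfl⟩ := hπ x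
        exact congr($h y))
  obtain ⟨n, s, hs⟩ := Module.Finite.exists_fin (R := A) (M := M →ₗ[A] A)
  refine ⟨n, LinearMap.pi s, fun φ ↦ ?_⟩
  have hφ : φ ∈ Submodule.span A (Set.range s) := hs ▸ trivial
  obtain ⟨c, rfl⟩ := (Submodule.mem_span_range_iff_exists_fun A).mp hφ
  refine ⟨∑ i, c i • LinearMap.proj i, ?_⟩
  ext x
  simp

lemma localized_split {n : ℕ} (f : M →ₗ[A] (Fin n → A))
    (hf : ∀ φ : M →ₗ[A] A, ∃ ψ : (Fin n → A) →ₗ[A] A, ψ ∘ₗ f = φ) (S : Submonoid A)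
    [Module.Free (Localization S) (LocalizedModule S M)] :
    ∃ l : LocalizedModule S (Fin n → A) →ₗ[Localization S] LocalizedModule S M,
      l ∘ₗ LocalizedModule.map S f = LinearMap.id := by
  have : Module.FinitePresentation A M := Module.finitePresentation_of_finite A M
  -- every functional extends
  have key : ∀ c : LocalizedModule S M →ₗ[Localization S] Localization S,
      ∃ d : LocalizedModule S (Fin n → A) →ₗ[Localization S] Localization S,
        d ∘ₗ LocalizedModule.map S f = c := by
    intro c
    obtain ⟨h, s, hs⟩ := Module.FinitePresentation.exists_lift_of_isLocalizedModule S
      (Algebra.linearMap A (Localization S))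
      (c.restrictScalars A ∘ₗ LocalizedModule.mkLinearMap S M)
    obtain ⟨ψ, hψ⟩ := hf h
    refine ⟨Localization.mk 1 s • IsLocalizedModule.mapExtendScalars S
      (LocalizedModule.mkLinearMap S (Fin n → A)) (Algebra.linearMap A (Localization S))
      (Localization S) ψ, ?_⟩
    apply LinearMap.restrictScalars_injective A
    apply IsLocalizedModule.linearMap_ext S (LocalizedModule.mkLinearMap S M)
      (Algebra.linearMap A (Localization S))
    ext x
    have h1 := congr($hs x)
    have h2 := congr($hψ x)
    have h3 : Localization.mk 1 s * algebraMap A (Localization S) s = 1 := by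
      rw [← Localization.mk_one_eq_algebraMap, Localization.mk_mul]
      simp [Localization.mk_self]
    simp only [LinearMap.comp_apply] at h1 h2
    have h4 : algebraMap A (Localization S) (ψ (f x)) =
      algebraMap A (Localization S) s * c (LocalizedModule.mkLinearMap S M x) := by
      rw [h2]
      simpa [Submonoid.smul_def, Algebra.smul_def] using h1
    have h5 : LocalizedModule.map S f (LocalizedModule.mkLinearMap S M x) =
      LocalizedModule.mkLinearMap S (Fin n → A) (f x) := by
      simp
    have h6 : IsLocalizedModule.mapExtendScalars S
      (LocalizedModule.mkLinearMap S (Fin n → A)) (Algebra.linearMap A (Localization S))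
      (Localization S) ψ (LocalizedModule.mkLinearMap S (Fin n → A) (f x)) =
       algebraMap A (Localization S) (ψ (f x)) := by
      exact IsLocalizedModule.map_apply S _ _ ψ (f x)
    simp only [LinearMap.comp_apply, LinearMap.restrictScalars_apply, LinearMap.smul_apply]
    rw [h5, h6, h4, smul_eq_mul, ← mul_assoc, h3, one_mul]
  let b := Module.Free.chooseBasis (Localization S) (LocalizedModule S M)
  choose d hd using fun i ↦ key (b.coord i)
  refine ⟨∑ i, (LinearMap.toSpanSingleton _ _ (b i)) ∘ₗ d i, ?_⟩
  apply LinearMap.ext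
  intro y
  have : ∀ i, d i (LocalizedModule.map S f y) = b.repr y i := fun i ↦ congr($(hd i) y)
  simp [this, b.sum_repr]

end

lemma not_extZ_zero_of_ann {A : Type} [CommRing A] {M : Type} [AddCommGroup M] [Module A M]
    (p : Ideal A) [p.IsPrime] (x : M) (hp : p = LinearMap.ker (LinearMap.toSpanSingleton A M x))
    (h : ExtZ (Localization.AtPrime p) (IsLocalRing.ResidueField (Localization.AtPrime p))
      (LocalizedModule p.primeCompl M) 0) : LocalizedModule.mkLinearMap p.primeCompl M x = 0 := by
  let R := Localization.AtPrime p
  let y := LocalizedModule.mkLinearMap p.primeCompl M x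
  have hle : IsLocalRing.maximalIdeal R ≤ LinearMap.ker (LinearMap.toSpanSingleton R _ y) := by
    rw [← Localization.AtPrime.map_eq_maximalIdeal, Ideal.map_le_iff_le_comap]
    intro a ha
    rw [hp] at ha
    have ha' : a • x = 0 := by simpa using ha
    have : a • y = 0 := by
      change a • LocalizedModule.mkLinearMap p.primeCompl M x = 0
      rw [← map_smul, ha', map_zero]
    change algebraMap A R a • y = 0
    rw [algebraMap_smul]
    exact this
  let φ : IsLocalRing.ResidueField R →ₗ[R] LocalizedModule p.primeCompl M :=
    Submodule.liftQ (IsLocalRing.maximalIdeal R) (LinearMap.toSpanSingleton R _ y) hle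
  have h1 : Ext.mk₀ (ModuleCat.ofHom φ) = 0 := 
    Subsingleton.elim (α := extGrp R (IsLocalRing.ResidueField R) _ 0) _ _
  rw [Ext.mk₀_eq_zero_iff] at h1
  have h2 : φ = 0 := congr(ModuleCat.Hom.hom $h1)
  have h3 : φ (Submodule.Quotient.mk 1) = y := by
    change Submodule.liftQ _ _ _ (Submodule.Quotient.mk 1) = y
    rw [Submodule.liftQ_apply]
    simp
  have h4 : y = 0 := by rw [← h3, h2]; rfl
  exact h4

lemma syzygy_backward (A : Type) [CommRing A] [IsNoetherianRing A] (i : ℕ) :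
    ∀ (M : Type) [AddCommGroup M] [Module A M] [Module.Finite A M]
    (_ : ∃ m, HasProjectiveDimensionLT (ModuleCat.of A M) (m + 1))
    (_ : ∀ (p : Ideal A) (_ : p.IsPrime),
        ((∀ j < i, ExtZ (Localization.AtPrime p)
            (IsLocalRing.ResidueField (Localization.AtPrime p))
            (LocalizedModule p.primeCompl M) j) ∨
          Module.Free (Localization.AtPrime p) (LocalizedModule p.primeCompl M))),
      IsSyzygy A i M := by
  induction i with
  | zero => intros; trivial
  | succ i ih =>
    intro M _ _ _ ⟨m, hm⟩ h
    obtain ⟨n, f, hf⟩ := exists_dual_gen A M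
    have hinj : Function.Injective f := by
      rw [← LinearMap.ker_eq_bot]
      by_contra hne
      have : Nontrivial (LinearMap.ker f) := Submodule.nontrivial_iff_ne_bot.mpr hne
      obtain ⟨p, hp⟩ := associatedPrimes.nonempty A (LinearMap.ker f)
      have hpM : IsAssociatedPrime p (LinearMap.ker f) := hp
      obtain ⟨hprime, ⟨x, hxf⟩, hx⟩ := isAssociatedPrime_iff.mp hpM
      have hx' : ∀ a : A, a ∈ p ↔ a • x = 0 := by
        intro a
        rw [hx, Submodule.mem_colon_singleton, Submodule.mem_bot, ← Subtype.coe_inj]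
        rfl
      have hk : p = LinearMap.ker (LinearMap.toSpanSingleton A M x) := by
        ext a
        rw [hx' a, LinearMap.mem_ker, LinearMap.toSpanSingleton_apply]
      have hne0 : LocalizedModule.mkLinearMap p.primeCompl M x ≠ 0 := by
        intro h0
        obtain ⟨s, hs⟩ := (IsLocalizedModule.eq_zero_iff p.primeCompl
          (LocalizedModule.mkLinearMap p.primeCompl M)).mp h0
        exact s.2 ((hx' s.1).mpr hs)
      rcases h p hprime with h1 | h1
      · exact hne0 (not_extZ_zero_of_ann p x hk (h1 0 (by omega)))
      · obtain ⟨l, hl⟩ := localized_split f hf p.primeCompl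
        apply hne0
        have h2 : LocalizedModule.map p.primeCompl f
            (LocalizedModule.mkLinearMap p.primeCompl M x) = 0 := by
          rw [LocalizedModule.mkLinearMap_apply, LocalizedModule.map_mk,
            LinearMap.mem_ker.mp hxf, LocalizedModule.zero_mk]
        have h3 := LinearMap.congr_fun hl (LocalizedModule.mkLinearMap p.primeCompl M x)
        rw [LinearMap.comp_apply, h2, map_zero] at h3
        exact h3.symm
    have hex : Function.Exact f (LinearMap.range f).mkQ := LinearMap.exact_map_mkQ_range f
    have hs := Submodule.mkQ_surjective (LinearMap.range f)
    refine ⟨n, f, hinj, ih _ ⟨m + 1, (projDim_left f _ hinj hex hs m).mpr hm⟩ fun p hp ↦ ?_⟩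
    have hinj' := LocalizedModule.map_injective p.primeCompl f hinj
    have hex' : Function.Exact (LocalizedModule.map p.primeCompl f)
        (LocalizedModule.map p.primeCompl (LinearMap.range f).mkQ) := LocalizedModule.map_exact p.primeCompl _ _ hex
    have hs' := LocalizedModule.map_surjective p.primeCompl _ hs
    have : Module.Free (Localization.AtPrime p) (LocalizedModule p.primeCompl (Fin n → A)) :=
      Module.free_of_isLocalizedModule p.primeCompl (LocalizedModule.mkLinearMap p.primeCompl _)
    by_cases hfree : Module.Free (Localization.AtPrime p) (LocalizedModule p.primeCompl M)
    · right
      obtain ⟨l, hl⟩ := localized_split f hf p.primeCompl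
      have hiff := hex'.split_tfae'.out 1 0
      obtain ⟨-, s, hsec⟩ := hiff.mp ⟨hs', l, hl⟩
      have : Module.Projective (Localization.AtPrime p)
        (LocalizedModule p.primeCompl ((Fin n → A) ⧸ LinearMap.range f)) :=
          Module.Projective.of_split s _ hsec
      exact Module.free_of_flat_of_isLocalRing
    · left
      have hM := (h p hp).resolve_right hfree
      have hR := auslander_buchsbaum (Localization.AtPrime p) m (LocalizedModule p.primeCompl M)
        (localized_pd _ m hm) hfree (i + 1) hM
      intro j hj
      exact extZ_right _ _ hinj' hex' hs' j (hM _ (by omega)) (extZ_free j (hR j (by omega)))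

/-- **Lemma 12.** A finitely generated module `M` of finite projective
dimension is an `i`-th syzygy iff for every prime `p`, either `depth M_p ≥ i` or `M_p` is
free over `A_p`. -/
theorem isSyzygy_iff_depth_or_free
    (A : Type) [CommRing A] [IsNoetherianRing A] [IsLocalRing A]
    (M : Type) [AddCommGroup M] [Module A M] [Module.Finite A M]
    (hpd : HasFinitePD A M) (i : ℕ) :
    IsSyzygy A i M ↔
      (∀ (p : Ideal A) (hp : p.IsPrime),
        haveI := hp
        ((i : ℕ∞) ≤ extDepth (Localization.AtPrime p) (LocalizedModule p.primeCompl M) ∨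
          Module.Free (Localization.AtPrime p) (LocalizedModule p.primeCompl M))) := by

  obtain ⟨m, hm⟩ := hpd.exists_lt
  constructor
  · intro h p hp
    by_cases hfree : Module.Free (Localization.AtPrime p) (LocalizedModule p.primeCompl M)
    · exact Or.inr hfree
    · left
      rw [le_extDepth_iff]
      have key : ∀ n ≤ i, ∀ j < n, ExtZ (Localization.AtPrime p)
          (IsLocalRing.ResidueField (Localization.AtPrime p))
          (LocalizedModule p.primeCompl M) j := by
        intro n
        induction n with
        | zero => intro _ j hj; omega
        | succ n ih =>
          intro hn j hj
          have hR := auslander_buchsbaum (Localization.AtPrime p) m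
            (LocalizedModule p.primeCompl M) (localized_pd _ m hm) hfree n (ih (by omega))
          exact syzygy_extZ p _ (n + 1) (fun j hj ↦ hR j (by omega)) i M h j hj (by omega)
      exact key i le_rfl
  · intro h
    refine syzygy_backward A i M ⟨m, hm⟩ fun p hp ↦ ?_
    have := h p hp
    rwa [le_extDepth_iff] at this
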